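/- There exists a finite constant C such that for all integers 0 ≤ k < h, if the chain Y starts at k then P(σ_h = ∞) < (h−k)/h + C·h^{−1/2}. -/

import Mathlib

open MeasureTheory ProbabilityTheory
open scoped ENNReal

/-- π(0,j) := δ_{0,j} and, for i > 0, π(i,j) := 2^{−i−j}·(i+j−1)!/((i−1)!·j!). -/
noncomputable def piGW (i j : ℕ) : ℝ :=
  if i = 0 then (if j = 0 then 1 else 0)
  else (2 : ℝ) ^ (-(i : ℝ) - (j : ℝ)) * (Nat.factorial (i + j - 1)) /
    ((Nat.factorial (i - 1)) * (Nat.factorial j))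

/-- `Y` is a Markov chain with transition probabilities `trans` started at `k`:
`P(Y_0 = k) = 1` and
`P(Y_0 = k_0, …, Y_n = k_n) = P(Y_0 = k_0) · ∏_{0 ≤ i < n} trans(k_i, k_{i+1})`. -/
def IsMarkovChainFrom {Ω : Type*} [MeasurableSpace Ω] (P : Measure Ω)
    (Y : ℕ → Ω → ℕ) (trans : ℕ → ℕ → ℝ) (k : ℕ) : Prop :=
  (∀ t, Measurable (Y t)) ∧
    ∀ (n : ℕ) (ks : ℕ → ℕ),
      P {ω | ∀ i ≤ n, Y i ω = ks i} =
        ENNReal.ofReal ((if ks 0 = k then 1 else 0) *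
          ∏ i ∈ Finset.range n, trans (ks i) (ks (i + 1)))

/-- `σ_h := inf{t ≥ 0 : Y_t ≥ h}` (with value `∞` if there is no such `t`). -/
noncomputable def sigma' {Ω : Type*} (Y : ℕ → Ω → ℕ) (h : ℕ) (ω : Ω) : ℕ∞ :=
  sInf ((↑) '' {t : ℕ | h ≤ Y t ω} : Set ℕ∞)

lemma piGW_succ (a j : ℕ) :
    piGW (a + 1) j = ((a + j).choose j : ℝ) / 2 ^ (a + j + 1) := by
  have h2 : (2 : ℝ) ^ (-((a + 1 : ℕ) : ℝ) - (j : ℝ)) = (2 ^ (a + j + 1))⁻¹ := by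
    rw [← Real.rpow_natCast, ← Real.rpow_neg (by norm_num)]
    congr 1
    push_cast
    ring
  have hc : ((a + j).choose j : ℝ) * (a.factorial * j.factorial) = (a + j).factorial := by
    rw [← mul_assoc]
    exact_mod_cast Nat.add_choose_mul_factorial_mul_factorial a j
  have h3 : a + 1 + j - 1 = a + j := by omega
  rw [piGW, if_neg (Nat.succ_ne_zero a), h2, h3, Nat.add_sub_cancel, ← hc]
  field_simp

lemma piGW_nonneg (i j : ℕ) : 0 ≤ piGW i j := by
  unfold piGW
  split_ifs <;> positivity

/-- Partial sums of binomial coefficients satisfy a Pascal-type recursion. -/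
lemma sum_choose_succ (N a : ℕ) :
    ∑ l ∈ Finset.range (a + 1), ((N + 1).choose l : ℝ) =
      2 * ∑ l ∈ Finset.range (a + 1), (N.choose l : ℝ) - N.choose a := by
  induction a with
  | zero => norm_num
  | succ a ih =>
    rw [Finset.sum_range_succ, ih, Finset.sum_range_succ _ (a + 1), Nat.choose_succ_succ]
    push_cast
    ring

/-- The mass that `piGW (a + 1)` gives to `[0, h)`, as a binomial tail. -/
lemma sum_piGW_succ (a h : ℕ) :
    ∑ j ∈ Finset.range h, piGW (a + 1) j =
      1 - (∑ l ∈ Finset.range (a + 1), ((a + h).choose l : ℝ)) / 2 ^ (a + h) := by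
  induction h with
  | zero =>
    have : ∑ l ∈ Finset.range (a + 1), (a.choose l : ℝ) = 2 ^ a := by
      exact_mod_cast Nat.sum_range_choose a
    simp [this]
  | succ h ih =>
    rw [Finset.sum_range_succ, ih, piGW_succ, ← add_assoc, sum_choose_succ, Nat.choose_symm_add]
    field_simp
    ring

lemma succ_mul_piGW_succ (a j : ℕ) :
    ((j : ℝ) + 1) * piGW (a + 1) (j + 1) = (a + 1) * piGW (a + 2) j := by
  have hc : (((a + j + 1).choose (j + 1) : ℕ) : ℝ) * (j + 1)
      = ((a + j + 1).choose j : ℕ) * (a + 1) := by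
    have := Nat.choose_succ_right_eq (a + j + 1) j
    rw [show a + j + 1 - j = a + 1 by omega] at this
    exact_mod_cast this
  rw [piGW_succ, piGW_succ, show a + 1 + j = a + j + 1 by ring, ← add_assoc]
  rw [mul_div_assoc', mul_div_assoc', mul_comm, hc, mul_comm]

/-- The truncated mean of `piGW (a + 1)`, as a binomial tail. -/
lemma sum_mul_piGW_succ (a h : ℕ) :
    ∑ j ∈ Finset.range (h + 1), (j : ℝ) * piGW (a + 1) j =
      (a + 1) *
        (1 - (∑ l ∈ Finset.range (a + 2), ((a + (h + 1)).choose l : ℝ)) / 2 ^ (a + (h + 1))) := by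
  have := sum_piGW_succ (a + 1) h
  rw [show a + 1 + h = a + (h + 1) by ring] at this
  rw [← this, Finset.sum_range_succ', Finset.mul_sum]
  simp [succ_mul_piGW_succ]

lemma sum_sub_mul_choose (N a : ℕ) :
    ∑ l ∈ Finset.range (a + 1), ((N : ℝ) - 2 * l) * N.choose l =
      (a + 1) * N.choose (a + 1) := by
  have key (b : ℕ) : ((b : ℝ) + 1) * N.choose (b + 1) = (N - b) * N.choose b := by
    have := Nat.choose_succ_right_eq N b
    rcases le_or_gt b N with hb | hb
    · have h2 : ((N.choose (b + 1) * (b + 1) : ℕ) : ℝ) = (N.choose b * (N - b) : ℕ) := by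
        rw [this]
      push_cast [Nat.cast_sub hb] at h2
      linarith
    · simp [Nat.choose_eq_zero_of_lt hb, Nat.choose_eq_zero_of_lt (hb.trans b.lt_succ_self)]
  induction a with
  | zero => simp
  | succ a ih =>
    rw [Finset.sum_range_succ, ih]
    have := key (a + 1)
    push_cast at this ⊢
    linarith

lemma sum_quadratic_mul_choose (N a : ℕ) :
    ∑ l ∈ Finset.range (a + 1),
      (((a : ℝ) - l) * (N + 1 - 2 * l) - a) * N.choose l = 0 := by
  induction a with
  | zero => simp
  | succ a ih =>
    have h1 := sum_sub_mul_choose N a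
    rw [Finset.sum_range_succ]
    have h2 : ∑ l ∈ Finset.range (a + 1),
        ((((a + 1 : ℕ) : ℝ) - l) * (N + 1 - 2 * l) - (a + 1 : ℕ)) * N.choose l =
        ∑ l ∈ Finset.range (a + 1), (((a : ℝ) - l) * (N + 1 - 2 * l) - a) * N.choose l +
        ∑ l ∈ Finset.range (a + 1), ((N : ℝ) - 2 * l) * N.choose l := by
      rw [← Finset.sum_add_distrib]
      refine Finset.sum_congr rfl fun l _ => ?_
      push_cast
      ring
    rw [h2, ih, h1]
    push_cast
    ring

/-- A binomial coefficient is controlled by the binomial tail below it. -/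
lemma succ_mul_choose_le (a h : ℕ) (hah : a + 1 < h) :
    ((a : ℝ) + 1) * (a + h).choose (a + 1) ≤
      (h + √(2 * h) - (a + 1)) * ∑ l ∈ Finset.range (a + 1), ((a + h).choose l : ℝ) := by
  have hR : (a : ℝ) + 1 + 1 ≤ h := by exact_mod_cast hah
  have ha0 : (0 : ℝ) ≤ a := a.cast_nonneg
  set q := √(2 * h) with hq
  have hqpos : 0 < q := Real.sqrt_pos.2 (by linarith)
  have hq2 : q ^ 2 = 2 * h := Real.sq_sqrt (by linarith)
  rw [← sum_sub_mul_choose, ← sub_nonneg, Finset.mul_sum, ← Finset.sum_sub_distrib]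
  have h0 := neg_eq_zero.2 (sum_quadratic_mul_choose (a + h) a)
  have hsum : 0 ≤ q * ∑ l ∈ Finset.range (a + 1),
      (((h : ℝ) + q - (a + 1)) * ((a + h).choose l) -
        (((a + h : ℕ) : ℝ) - 2 * l) * ((a + h).choose l)) := by
    rw [Finset.mul_sum, ← h0, ← Finset.sum_neg_distrib]
    refine Finset.sum_le_sum fun l hl => ?_
    have hla : (l : ℝ) ≤ a := by exact_mod_cast Nat.lt_succ_iff.1 (Finset.mem_range.1 hl)
    rw [← sub_mul, ← mul_assoc, ← neg_mul]
    refine mul_le_mul_of_nonneg_right ?_ (Nat.cast_nonneg _)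
    push_cast
    nlinarith [sq_nonneg (2 * ((a : ℝ) - l) + 1 - q),
      mul_nonneg (sub_nonneg.2 hla) (sub_nonneg.2 hR)]
  exact nonneg_of_mul_nonneg_right hsum hqpos

lemma sum_piGW_le_one (i h : ℕ) : ∑ j ∈ Finset.range h, piGW i j ≤ 1 := by
  cases i with
  | zero =>
    simp only [piGW, if_true, Finset.sum_ite_eq']
    split_ifs <;> norm_num
  | succ a =>
    rw [sum_piGW_succ]
    exact sub_le_self _ (by positivity)

lemma sum_piGW_mul_sub_le {i h : ℕ} (hi : i < h) :
    ∑ j ∈ Finset.range h, piGW i j * (h + √(2 * h) - j) ≤ h + √(2 * h) - i := by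
  cases i with
  | zero => simp [piGW, hi]
  | succ a =>
    obtain ⟨b, rfl⟩ : ∃ b, h = b + 1 := ⟨h - 1, by omega⟩
    have h1 := sum_piGW_succ a (b + 1)
    have h2 := sum_mul_piGW_succ a b
    have h3 := succ_mul_choose_le a (b + 1) hi
    set M : ℝ := ((b + 1 : ℕ) : ℝ) + √(2 * (b + 1 : ℕ)) with hM
    have h4 : ∑ j ∈ Finset.range (b + 1), piGW (a + 1) j * (M - j) =
        M * ∑ j ∈ Finset.range (b + 1), piGW (a + 1) j -
          ∑ j ∈ Finset.range (b + 1), (j : ℝ) * piGW (a + 1) j := by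
      rw [Finset.mul_sum, ← Finset.sum_sub_distrib]
      exact Finset.sum_congr rfl fun j _ => by ring
    rw [h4, h1, h2, Finset.sum_range_succ _ (a + 1)]
    set W := ∑ l ∈ Finset.range (a + 1), ((a + (b + 1)).choose l : ℝ)
    set w : ℝ := (((a + (b + 1)).choose (a + 1) : ℕ) : ℝ)
    have hp : (0 : ℝ) < 2 ^ (a + (b + 1)) := by positivity
    have h5 : ((a + 1) * w - (M - (a + 1)) * W) / 2 ^ (a + (b + 1)) ≤ 0 :=
      div_nonpos_of_nonpos_of_nonneg (by linarith) hp.le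
    have h6 : M * (1 - W / 2 ^ (a + (b + 1))) - (a + 1) * (1 - (W + w) / 2 ^ (a + (b + 1))) =
      M - (a + 1) + ((a + 1) * w - (M - (a + 1)) * W) / 2 ^ (a + (b + 1)) := by ring
    rw [h6]
    push_cast
    linarith

/-- The probability that the chain started at `i` makes `n` steps, all of them into `[0, h)`. -/
noncomputable def stayProb (h : ℕ) : ℕ → ℕ → ℝ
  | 0, _ => 1
  | n + 1, i => ∑ j ∈ Finset.range h, piGW i j * stayProb h n j

lemma stayProb_nonneg (h n i : ℕ) : 0 ≤ stayProb h n i := by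
  induction n generalizing i with
  | zero => simp [stayProb]
  | succ n ih => exact Finset.sum_nonneg fun j _ => mul_nonneg (piGW_nonneg i j) (ih j)

lemma stayProb_mul_le {h i : ℕ} (hi : i < h) (n : ℕ) :
    stayProb h n i * (h + √(2 * h)) ≤
      h + √(2 * h) - i +
        (if i = 0 then 0 else (h + √(2 * h)) * (1 - (1 / 2 : ℝ) ^ h) ^ n) := by
  have hM : (h : ℝ) ≤ h + √(2 * h) := le_add_of_nonneg_right (Real.sqrt_nonneg _)
  set M : ℝ := h + √(2 * h) with hMdef
  have hM0 : 0 ≤ M := (Nat.cast_nonneg h).trans hM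
  have hr : 0 ≤ 1 - (1 / 2 : ℝ) ^ h :=
    sub_nonneg.2 (pow_le_one₀ (by norm_num) (by norm_num))
  induction n generalizing i with
  | zero =>
    have : (i : ℝ) ≤ h := by exact_mod_cast hi.le
    by_cases h0 : i = 0
    · simp [stayProb, h0]
    · simp [stayProb, h0]
      linarith
  | succ n ih =>
    set r := 1 - (1 / 2 : ℝ) ^ h with hrdef
    have h1 : stayProb h (n + 1) i * M ≤
        ∑ j ∈ Finset.range h, piGW i j * (M - j) +
          ∑ j ∈ Finset.range h, piGW i j * (if j = 0 then 0 else M * r ^ n) := by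
      rw [stayProb, Finset.sum_mul, ← Finset.sum_add_distrib]
      refine Finset.sum_le_sum fun j hj => ?_
      rw [mul_assoc, ← mul_add]
      exact mul_le_mul_of_nonneg_left (ih (Finset.mem_range.1 hj)) (piGW_nonneg i j)
    refine h1.trans (add_le_add (sum_piGW_mul_sub_le hi) ?_)
    by_cases h0 : i = 0
    · rw [if_pos h0]
      refine (Finset.sum_eq_zero fun j _ => ?_).le
      by_cases hj : j = 0 <;> simp [piGW, h0, hj]
    · rw [if_neg h0]
      obtain ⟨b, rfl⟩ : ∃ b, h = b + 1 := ⟨h - 1, by omega⟩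
      obtain ⟨a, rfl⟩ : ∃ a, i = a + 1 := ⟨i - 1, by omega⟩
      have h2 := sum_piGW_le_one (a + 1) (b + 1)
      rw [Finset.sum_range_succ'] at h2 ⊢
      have h3 : (1 / 2 : ℝ) ^ (b + 1) ≤ piGW (a + 1) 0 := by
        rw [piGW_succ]
        simp only [add_zero, Nat.choose_zero_right, Nat.cast_one, ← one_div_pow]
        exact pow_le_pow_of_le_one (by norm_num) (by norm_num) hi.le
      simp only [Nat.add_eq_zero_iff, one_ne_zero, and_false, if_false, if_true, mul_zero,
        add_zero, ← Finset.sum_mul]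
      rw [pow_succ, ← mul_assoc M, mul_comm _ (M * r ^ n)]
      exact mul_le_mul_of_nonneg_left (by linarith) (mul_nonneg hM0 (pow_nonneg hr n))

lemma IsMarkovChainFrom.measure_stay_le {Ω : Type*} [MeasurableSpace Ω] {P : Measure Ω}
    {Y : ℕ → Ω → ℕ} {k : ℕ} (hY : IsMarkovChainFrom P Y piGW k) (h n m : ℕ) (ks : ℕ → ℕ) :
    P {ω | (∀ i ≤ m, Y i ω = ks i) ∧ ∀ i, Y i ω < h} ≤
      ENNReal.ofReal ((if ks 0 = k then 1 else 0) *
        (∏ i ∈ Finset.range m, piGW (ks i) (ks (i + 1))) * stayProb h n (ks m)) := by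
  induction n generalizing m ks with
  | zero =>
    rw [stayProb, mul_one, ← hY.2]
    exact measure_mono fun ω hω => hω.1
  | succ n ih =>
    have hsub : {ω | (∀ i ≤ m, Y i ω = ks i) ∧ ∀ i, Y i ω < h} ⊆
        ⋃ j ∈ Finset.range h, {ω | (∀ i ≤ m + 1, Y i ω = Function.update ks (m + 1) j i) ∧
          ∀ i, Y i ω < h} := by
      intro ω hω
      simp only [Set.mem_iUnion, Finset.mem_range]
      refine ⟨Y (m + 1) ω, hω.2 _, fun i hi => ?_, hω.2⟩
      rcases hi.lt_or_eq with hi | rfl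
      · rw [Function.update_of_ne hi.ne]
        exact hω.1 i (by omega)
      · simp
    refine (measure_mono hsub).trans ((measure_biUnion_finset_le _ _).trans ?_)
    have h0 : (0 : ℝ) ≤ (if ks 0 = k then 1 else 0) *
        (∏ i ∈ Finset.range m, piGW (ks i) (ks (i + 1))) :=
      mul_nonneg (by split_ifs <;> norm_num) (Finset.prod_nonneg fun _ _ => piGW_nonneg _ _)
    rw [stayProb, Finset.mul_sum, ENNReal.ofReal_sum_of_nonneg fun j _ =>
      mul_nonneg h0 (mul_nonneg (piGW_nonneg _ _) (stayProb_nonneg _ _ _))]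
    refine Finset.sum_le_sum fun j _ => (ih (m + 1) _).trans_eq ?_
    congr 1
    have hprod : ∏ i ∈ Finset.range m, piGW (Function.update ks (m + 1) j i)
        (Function.update ks (m + 1) j (i + 1)) =
        ∏ i ∈ Finset.range m, piGW (ks i) (ks (i + 1)) := by
      refine Finset.prod_congr rfl fun i hi => ?_
      have := Finset.mem_range.1 hi
      rw [Function.update_of_ne (by omega), Function.update_of_ne (by omega)]
    rw [Finset.prod_range_succ, hprod, Function.update_self,
      Function.update_of_ne (Nat.succ_ne_zero m).symm,
      Function.update_of_ne (Nat.lt_succ_self m).ne]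
    ring

lemma lt_of_sigma'_eq_top {Ω : Type*} [MeasurableSpace Ω] {Y : ℕ → Ω → ℕ} {h : ℕ} {ω : Ω}
    (hω : sigma' Y h ω = ⊤) (i : ℕ) : Y i ω < h := by
  by_contra! hi
  exact ENat.natCast_ne_top i (sInf_eq_top.1 hω _ ⟨i, hi, rfl⟩)

lemma IsMarkovChainFrom.measure_sigma'_eq_top_le {Ω : Type*} [MeasurableSpace Ω]
    {P : Measure Ω} [IsProbabilityMeasure P] {Y : ℕ → Ω → ℕ} {k : ℕ}
    (hY : IsMarkovChainFrom P Y piGW k) (h n : ℕ) :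
    P {ω | sigma' Y h ω = ⊤} ≤ ENNReal.ofReal (stayProb h n k) := by
  have h0 : P {ω | Y 0 ω = k} = 1 := by simpa using hY.2 0 fun _ => k
  have hae : ∀ᵐ ω ∂P, Y 0 ω = k :=
    (prob_compl_eq_zero_iff (hY.1 0 (measurableSet_singleton k))).2 h0
  have h1 := hY.measure_stay_le h n 0 fun _ => k
  simp only [if_true, Finset.range_zero, Finset.prod_empty, one_mul] at h1
  refine (measure_mono_ae ?_).trans h1
  filter_upwards [hae] with ω hω hs
  refine ⟨fun i hi => ?_, lt_of_sigma'_eq_top hs⟩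
  rw [Nat.le_zero.1 hi, hω]

/-- There exists a finite constant C such that for all integers 0 ≤ k < h, if
the chain Y starts at k then P(σ_h = ∞) < (h−k)/h + C·h^{−1/2}. -/
theorem stmt_16 :
    ∃ C : ℝ,
      ∀ (h k : ℕ), k < h →
        ∀ (Ω : Type) (_ : MeasurableSpace Ω) (P : Measure Ω) (Y : ℕ → Ω → ℕ),
          IsProbabilityMeasure P → IsMarkovChainFrom P Y piGW k →
          P {ω | sigma' Y h ω = ⊤} <
            ENNReal.ofReal (((h : ℝ) - (k : ℝ)) / (h : ℝ) +
              C * (h : ℝ) ^ (-(1 : ℝ) / 2)) := by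
  refine ⟨2, fun h k hk Ω _ P Y _ hY => ?_⟩
  have hh : (0 : ℝ) < h := by exact_mod_cast (Nat.zero_le k).trans_lt hk
  have hkh : (k : ℝ) ≤ h := by exact_mod_cast hk.le
  have hs : 0 < √(h : ℝ) := Real.sqrt_pos.2 hh
  have hs2 : √(h : ℝ) ^ 2 = h := Real.sq_sqrt hh.le
  have hpow : (h : ℝ) ^ (-(1 : ℝ) / 2) = 1 / √h := by
    rw [neg_div, Real.rpow_neg hh.le, Real.sqrt_eq_rpow, one_div (_ ^ _)]
  set M : ℝ := h + √(2 * h) with hM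
  have hq : 0 < √(2 * (h : ℝ)) := Real.sqrt_pos.2 (by linarith)
  have hqlt : √(2 * (h : ℝ)) < 2 * √h := by
    rw [Real.sqrt_lt' (by positivity)]
    nlinarith
  have hM0 : 0 < M := by positivity
  have hgap : 1 - (k : ℝ) / M < ((h : ℝ) - k) / h + 2 * (h : ℝ) ^ (-(1 : ℝ) / 2) := by
    have h1 : (k : ℝ) / h - k / M ≤ √(2 * h) / h := by
      rw [div_sub_div _ _ hh.ne' hM0.ne', div_le_div_iff₀ (by positivity) hh]
      have : (k : ℝ) * M - h * k = k * √(2 * h) := by rw [hM]; ring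
      rw [this]
      have : (k : ℝ) ≤ M := by linarith
      nlinarith [mul_le_mul_of_nonneg_right this (mul_pos hq hh).le]
    have h2 : √(2 * (h : ℝ)) / h < 2 * (1 / √h) := by
      rw [mul_one_div, div_lt_div_iff₀ hh hs]
      nlinarith
    rw [hpow, sub_div, div_self hh.ne']
    linarith
  have hr0 : 0 ≤ 1 - (1 / 2 : ℝ) ^ h :=
    sub_nonneg.2 (pow_le_one₀ (by norm_num) (by norm_num))
  obtain ⟨n, hn⟩ := exists_pow_lt_of_lt_one (sub_pos.2 hgap)
    (show 1 - (1 / 2 : ℝ) ^ h < 1 from sub_lt_self _ (by positivity))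
  have hv : stayProb h n k ≤ 1 - (k : ℝ) / M + (1 - (1 / 2 : ℝ) ^ h) ^ n := by
    have h1 := stayProb_mul_le hk n
    rw [← hM] at h1
    have h2 : (if k = 0 then 0 else M * (1 - (1 / 2 : ℝ) ^ h) ^ n) ≤
        M * (1 - (1 / 2 : ℝ) ^ h) ^ n := by
      split_ifs
      · positivity
      · exact le_rfl
    refine ((le_div_iff₀ hM0).2 (h1.trans (add_le_add_right h2 _))).trans_eq ?_
    field_simp
  have hlt := (lt_of_le_of_lt hv (by linarith :
    _ < ((h : ℝ) - k) / h + 2 * (h : ℝ) ^ (-(1 : ℝ) / 2)))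
  exact (hY.measure_sigma'_eq_top_le h n).trans_lt
    ((ENNReal.ofReal_lt_ofReal_iff ((stayProb_nonneg h n k).trans_lt hlt)).2 hlt)
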